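/- For every word w of rank n in the Fibonacci poset Z(k), the number of standard k-ribbon Fibonacci tableaux of shape w with entries 1, ..., n equals the number of k-ribbon Fibonacci path tableaux of shape w, which in turn equals e(w), the number of saturated chains from ∅ to w in Z(k). -/

import Mathlib

namespace KRF

/-- A letter of the alphabet `{1_1, …, 1_k, 2}`:  `one j` stands for the letter `1_j`
(with `1 ≤ j ≤ k` for genuine letters), and `two` stands for the letter `2`. -/
inductive Letter (k : ℕ) : Type where
  | one : ℕ → Letter k
  | two : Letter k
deriving DecidableEq

/-- A word over the alphabet `{1_1, …, 1_k, 2}`, listed from the leftmost letter to the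
rightmost letter. -/
abbrev Word (k : ℕ) := List (Letter k)

/-- The contribution of a letter to the rank: each `1_j` counts `1` and each `2` counts `2`. -/
def Letter.rank {k : ℕ} : Letter k → ℕ
  | .one _ => 1
  | .two => 2

/-- The rank of a word: the sum of its letters. -/
def Word.rank {k : ℕ} (w : Word k) : ℕ := (w.map Letter.rank).sum

/-- The letter `1_j` is valid when `1 ≤ j ≤ k`. -/
def Letter.Valid (k : ℕ) : Letter k → Prop
  | .one j => 1 ≤ j ∧ j ≤ k
  | .two => True

/-- A genuine word of the Fibonacci poset `Z(k)`: all of its letters are valid. -/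
def Word.Valid (k : ℕ) (w : Word k) : Prop := ∀ l ∈ w, l.Valid k

/-- The cover relation of the Fibonacci poset `Z(k)`:  `z` is covered by `w` iff `z` is
obtained from `w` either by changing a `2` into some `1_j` when all letters to the left of
that `2` are `2`'s, or by deleting the leftmost letter of the form `1_j`. -/
def ZCovers (k : ℕ) (z w : Word k) : Prop :=
  (∃ (p s : Word k) (j : ℕ), (∀ l ∈ p, l = Letter.two) ∧ 1 ≤ j ∧ j ≤ k ∧
      w = p ++ Letter.two :: s ∧ z = p ++ Letter.one j :: s) ∨
  (∃ (p s : Word k) (j : ℕ), (∀ l ∈ p, l = Letter.two) ∧ 1 ≤ j ∧ j ≤ k ∧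
      w = p ++ Letter.one j :: s ∧ z = p ++ s)

/-- `c 0 ⋖ c 1 ⋖ ⋯ ⋖ c n` is a saturated chain in `Z(k)` starting at the empty word. -/
def IsZChain (k n : ℕ) (c : ℕ → Word k) : Prop :=
  c 0 = [] ∧ ∀ i, i < n → ZCovers k (c i) (c (i + 1))

end KRF
namespace KRF

/-- A column of a (tiled and filled) `k`-ribbon Fibonacci tableau.
`single h v` is a column of height 1 (shape letter `1_h`) tiled by one `k`-ribbon of
height `h` filled with the value `v`.
`double ht hb vt vb` is a column of height 2 (shape letter `2`) tiled by a `k`-ribbon of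
height `ht` filled with `vt` stacked on top of a `k`-ribbon of height `hb` (always
`hb = k + 1 - ht` for genuine tableaux) filled with `vb`. -/
inductive Col (k : ℕ) : Type where
  | single : ℕ → ℕ → Col k
  | double : ℕ → ℕ → ℕ → ℕ → Col k
deriving DecidableEq

/-- A (tiled, filled) `k`-ribbon Fibonacci tableau: its list of columns, from the leftmost
column to the rightmost one. -/
abbrev Tab (k : ℕ) := List (Col k)

/-- The shape letter of a column. -/
def Col.shape {k : ℕ} : Col k → Letter k
  | .single h _ => Letter.one h
  | .double _ _ _ _ => Letter.two

/-- The `k`-ribbon Fibonacci shape (a word) underlying a tableau. -/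
def Tab.shape {k : ℕ} (T : Tab k) : Word k := T.map Col.shape

/-- The value in the bottom `k`-ribbon of a column. -/
def Col.bottomVal {k : ℕ} : Col k → ℕ
  | .single _ v => v
  | .double _ _ _ vb => vb

/-- The heights occurring in a column are genuine ribbon heights: between `1` and `k`,
and in a column of height 2 the two heights sum to `k + 1`. -/
def Col.HeightsValid (k : ℕ) : Col k → Prop
  | .single h _ => 1 ≤ h ∧ h ≤ k
  | .double ht hb _ _ => 1 ≤ ht ∧ ht ≤ k ∧ hb = k + 1 - ht

/-- The list of all entries of a tableau (one for each `k`-ribbon). -/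
def Tab.entries {k : ℕ} (T : Tab k) : List ℕ :=
  (T.map fun c => match c with
    | Col.single _ v => [v]
    | Col.double _ _ vt vb => [vt, vb]).flatten

/-- The list of the bottom-ribbon values of the columns of a tableau. -/
def Tab.bottoms {k : ℕ} (T : Tab k) : List ℕ := T.map Col.bottomVal

/-- `T` is a standard `k`-ribbon Fibonacci tableau with entries `1, …, n`:
heights are valid, the entries are exactly `1, …, n`,  and the tableau can be built by
placing `n, n-1, …, 1` in order, each new `k`-ribbon being either appended (as a new
rightmost height-1 column) to the shape formed by the `k`-ribbons containing larger
entries, or stacked on top of a single such `k`-ribbon.  Equivalently (and this is how we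
formalize it): the bottom entries strictly decrease from left to right (in particular the
`k`-ribbon containing the leftmost square of the bottom row contains `n`), and in each
column of height 2 the top entry is smaller than the bottom entry. -/
def IsStandardTab (k n : ℕ) (T : Tab k) : Prop :=
  (∀ c ∈ T, Col.HeightsValid k c) ∧
  (Tab.entries T).Perm (List.range' 1 n) ∧
  List.Chain' (fun a b => b < a) (Tab.bottoms T) ∧
  (∀ c ∈ T, ∀ ht hb vt vb, c = Col.double ht hb vt vb → vt < vb)

/-- Updating a (partial) path tableau along one cover step `z ⋖ w` of `Z(k)`, placing the
value `i` in the `k` new squares of `w` relative to `z`:  if `w` is obtained from `z` by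
inserting a letter `1_j` after the prefix of `2`'s, a new height-1 column with a single
ribbon of height `j` filled with `i` is created there; if `w` is obtained from `z` by
changing the letter `1_h` just after the prefix of `2`'s into a `2`, the `k` new squares
of that column form a `k`-ribbon of height `k + 1 - h` filled with `i`, stacked on top of
the already present `k`-ribbon of height `h`. -/
def updateTab (k : ℕ) (i : ℕ) : Word k → Word k → Tab k → Tab k
  | Letter.two :: z', Letter.two :: w', c :: T => c :: updateTab k i z' w' T
  | Letter.one h :: _, Letter.two :: _, Col.single _ v :: T =>
      Col.double (k + 1 - h) h i v :: T
  | z, Letter.one j :: w', T => if z = w' then Col.single j i :: T else T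
  | _, _, T => T

/-- The `k`-ribbon Fibonacci path tableau determined by a saturated chain in `Z(k)`:
for each `i = 1, …, n` the value `i` is placed in the `k` new squares of `c i` relative
to `c (i-1)`. -/
def chainTab (k : ℕ) (c : ℕ → Word k) : ℕ → Tab k
  | 0 => []
  | m + 1 => updateTab k (m + 1) (c m) (c (m + 1)) (chainTab k c m)

/-- `T` is a `k`-ribbon Fibonacci path tableau with entries `1, …, n`: it is obtained
from some saturated chain `∅ = c 0 ⋖ c 1 ⋖ ⋯ ⋖ c n` in `Z(k)` by placing `i`'s in the
`k` new squares created at the `i`-th step. -/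
def IsPathTab (k n : ℕ) (T : Tab k) : Prop :=
  ∃ c : ℕ → Word k, IsZChain k n c ∧ T = chainTab k c n

end KRF
namespace KRF

/-- `e(w)`: the number of saturated chains `∅ = c 0 ⋖ c 1 ⋖ ⋯ ⋖ c n = w` in `Z(k)`. -/
noncomputable def chainCount (k n : ℕ) (w : Word k) : ℕ :=
  Nat.card {c : Fin (n + 1) → Word k //
    c 0 = [] ∧ (∀ i : Fin n, ZCovers k (c i.castSucc) (c i.succ)) ∧ c (Fin.last n) = w}

end KRF
namespace KRF

theorem not_zcovers_nil {k : ℕ} (z : Word k) : ¬ ZCovers k z [] := by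
  rintro (⟨p, s, j, -, -, -, h, -⟩ | ⟨p, s, j, -, -, -, h, -⟩) <;> simp at h

theorem zcovers_one {k : ℕ} (z w : Word k) (j : ℕ) :
    ZCovers k z (Letter.one j :: w) ↔ (1 ≤ j ∧ j ≤ k) ∧ z = w := by
  constructor
  · rintro (⟨p, s, i, hp, h1, h2, h, h'⟩ | ⟨p, s, i, hp, h1, h2, h, h'⟩)
    · cases p with
      | nil => simp at h
      | cons a p =>
        have := hp a (by simp)
        subst this
        simp at h
    · cases p with
      | nil =>
        simp at h
        obtain ⟨rfl, rfl⟩ := h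
        exact ⟨⟨h1, h2⟩, by simpa using h'⟩
      | cons a p =>
        have := hp a (by simp)
        subst this
        simp at h
  · rintro ⟨⟨h1, h2⟩, rfl⟩
    exact Or.inr ⟨[], z, j, by simp, h1, h2, rfl, rfl⟩

theorem zcovers_two {k : ℕ} (z w : Word k) :
    ZCovers k z (Letter.two :: w) ↔
      (∃ j, (1 ≤ j ∧ j ≤ k) ∧ z = Letter.one j :: w) ∨
      (∃ z', z = Letter.two :: z' ∧ ZCovers k z' w) := by
  constructor
  · rintro (⟨p, s, i, hp, h1, h2, h, h'⟩ | ⟨p, s, i, hp, h1, h2, h, h'⟩)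
    · cases p with
      | nil =>
        simp at h
        subst h
        exact Or.inl ⟨i, ⟨h1, h2⟩, h'⟩
      | cons a p =>
        have := hp a (by simp)
        subst this
        simp at h
        exact Or.inr ⟨_, h', Or.inl ⟨p, s, i, fun l hl => hp l (by simp [hl]), h1, h2, h, rfl⟩⟩
    · cases p with
      | nil => simp at h
      | cons a p =>
        have := hp a (by simp)
        subst this
        simp at h
        exact Or.inr ⟨_, h', Or.inr ⟨p, s, i, fun l hl => hp l (by simp [hl]), h1, h2, h, rfl⟩⟩
  · rintro (⟨j, ⟨h1, h2⟩, rfl⟩ | ⟨z', rfl, h⟩)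
    · exact Or.inl ⟨[], w, j, by simp, h1, h2, rfl, rfl⟩
    · rcases h with ⟨p, s, i, hp, h1, h2, h, h'⟩ | ⟨p, s, i, hp, h1, h2, h, h'⟩
      · exact Or.inl ⟨Letter.two :: p, s, i, by simpa using hp, h1, h2, by simp [h], by simp [h']⟩
      · exact Or.inr ⟨Letter.two :: p, s, i, by simpa using hp, h1, h2, by simp [h], by simp [h']⟩

/-- The words covered by a valid word. -/
def lower (k : ℕ) : Word k → Finset (Word k)
  | [] => ∅
  | Letter.one _ :: v => {v}
  | Letter.two :: v =>
      ((Finset.Icc 1 k).image fun j => Letter.one j :: v) ∪ (lower k v).image (Letter.two :: ·)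

/-- The product formula for the number of chains. -/
def F (k : ℕ) : Word k → ℕ
  | [] => 1
  | Letter.one _ :: v => F k v
  | Letter.two :: v => k * (Word.rank v + 1) * F k v

theorem valid_cons {k : ℕ} (l : Letter k) (w : Word k) :
    Word.Valid k (l :: w) ↔ l.Valid k ∧ Word.Valid k w := by
  simp [Word.Valid]

theorem rank_one {k : ℕ} (j : ℕ) (w : Word k) :
    Word.rank (Letter.one j :: w) = Word.rank w + 1 := by
  simp [Word.rank, Letter.rank]; omega

theorem rank_two {k : ℕ} (w : Word k) :
    Word.rank (Letter.two :: w) = Word.rank w + 2 := by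
  simp [Word.rank, Letter.rank]; omega

theorem rank_nil {k : ℕ} : Word.rank ([] : Word k) = 0 := rfl

theorem mem_lower {k : ℕ} (w : Word k) (hw : Word.Valid k w) (z : Word k) :
    z ∈ lower k w ↔ ZCovers k z w := by
  induction w generalizing z with
  | nil => simp [lower, not_zcovers_nil]
  | cons l w ih =>
    rw [valid_cons] at hw
    cases l with
    | one j =>
      have := hw.1
      simp only [Letter.Valid] at this
      simp [lower, zcovers_one, this]
    | two =>
      simp only [lower, Finset.mem_union, Finset.mem_image, Finset.mem_Icc, zcovers_two]
      refine or_congr ?_ ?_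
      · exact exists_congr fun j => and_congr_right fun _ => eq_comm
      · refine exists_congr fun z' => ?_
        rw [ih hw.2, and_comm]
        exact and_congr_left fun _ => eq_comm

theorem lower_valid {k : ℕ} (w : Word k) (hw : Word.Valid k w) (z : Word k)
    (hz : z ∈ lower k w) : Word.Valid k z ∧ Word.rank z + 1 = Word.rank w := by
  induction w generalizing z with
  | nil => simp [lower] at hz
  | cons l w ih =>
    rw [valid_cons] at hw
    cases l with
    | one j =>
      simp [lower] at hz
      subst hz
      exact ⟨hw.2, by rw [rank_one]⟩
    | two =>
      simp only [lower, Finset.mem_union, Finset.mem_image, Finset.mem_Icc] at hz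
      rcases hz with ⟨j, hj, rfl⟩ | ⟨z', hz', rfl⟩
      · exact ⟨by rw [valid_cons]; exact ⟨hj, hw.2⟩, by rw [rank_one, rank_two]⟩
      · obtain ⟨h1, h2⟩ := ih hw.2 z' hz'
        exact ⟨by rw [valid_cons]; exact ⟨trivial, h1⟩, by rw [rank_two, rank_two]; omega⟩

theorem sum_lower_F {k : ℕ} (w : Word k) (hw : Word.Valid k w) (hne : w ≠ []) :
    ∑ z ∈ lower k w, F k z = F k w := by
  induction w with
  | nil => exact absurd rfl hne
  | cons l w ih =>
    rw [valid_cons] at hw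
    cases l with
    | one j => simp [lower, F]
    | two =>
      rw [lower, Finset.sum_union, Finset.sum_image, Finset.sum_image]
      · simp only [F]
        have h1 : ∑ z ∈ lower k w, k * (Word.rank z + 1) * F k z
            = k * Word.rank w * ∑ z ∈ lower k w, F k z := by
          rw [Finset.mul_sum]
          refine Finset.sum_congr rfl fun z hz => ?_
          rw [(lower_valid w hw.2 z hz).2]
        rw [h1]
        by_cases h : w = []
        · subst h
          simp [rank_nil]
        · rw [ih hw.2 h]
          simp
          ring
      · intro a _ b _ h
        simpa using h
      · intro a _ b _ h
        simpa using h
      · rw [Finset.disjoint_left]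
        intro a ha hb
        simp only [Finset.mem_image] at ha hb
        obtain ⟨j, -, rfl⟩ := ha
        obtain ⟨z, -, h⟩ := hb
        simp at h

/-- Chains of length `n` ending in `w`, as finite sequences. -/
def FinChain (k n : ℕ) (w : Word k) (c : Fin (n + 1) → Word k) : Prop :=
  c 0 = [] ∧ (∀ i : Fin n, ZCovers k (c i.castSucc) (c i.succ)) ∧ c (Fin.last n) = w

theorem finChain_succ {k n : ℕ} (w : Word k) (c : Fin (n + 2) → Word k) :
    FinChain k (n + 1) w c ↔ ∃ z, ZCovers k z w ∧ ∃ c' : Fin (n + 1) → Word k,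
      FinChain k n z c' ∧ (Fin.snoc c' w : Fin (n + 2) → Word k) = c := by
  constructor
  · rintro ⟨h0, h1, h2⟩
    refine ⟨c (Fin.last n).castSucc, ?_, Fin.init c, ⟨h0, ?_, rfl⟩, ?_⟩
    · have := h1 (Fin.last n)
      rwa [Fin.succ_last, h2] at this
    · intro i
      have := h1 i.castSucc
      rwa [Fin.succ_castSucc] at this
    · rw [← h2]
      exact Fin.snoc_init_self c
  · rintro ⟨z, hz, c', ⟨h0, h1, h2⟩, rfl⟩
    refine ⟨?_, ?_, by simp⟩
    · rw [← Fin.castSucc_zero, Fin.snoc_castSucc]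
      exact h0
    · intro i
      rw [Fin.snoc_castSucc]
      refine Fin.lastCases ?_ (fun i => ?_) i
      · rw [Fin.succ_last, Fin.snoc_last, h2]
        exact hz
      · rw [Fin.succ_castSucc, Fin.snoc_castSucc]
        exact h1 i

theorem chain_finset {k : ℕ} (n : ℕ) : ∀ w : Word k, Word.Valid k w → Word.rank w = n →
    ∃ A : Finset (Fin (n + 1) → Word k), (∀ c, c ∈ A ↔ FinChain k n w c) ∧ A.card = F k w := by
  induction n with
  | zero =>
    intro w hw hr
    have : w = [] := by
      cases w with
      | nil => rfl
      | cons l w => cases l <;> simp [rank_one, rank_two] at hr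
    subst this
    refine ⟨{fun _ => []}, fun c => ?_, rfl⟩
    simp only [Finset.mem_singleton, FinChain]
    constructor
    · rintro rfl
      exact ⟨rfl, fun i => i.elim0, rfl⟩
    · rintro ⟨h, -, -⟩
      funext i
      have hi : i = 0 := Fin.ext (by simp)
      rw [hi, h]
  | succ n ih =>
    intro w hw hr
    have hz : ∀ z : Word k, ∃ A : Finset (Fin (n + 1) → Word k), z ∈ lower k w →
        (∀ c, c ∈ A ↔ FinChain k n z c) ∧ A.card = F k z := by
      intro z
      by_cases h : z ∈ lower k w
      · obtain ⟨h1, h2⟩ := lower_valid w hw z h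
        obtain ⟨A, hA⟩ := ih z h1 (by omega)
        exact ⟨A, fun _ => hA⟩
      · exact ⟨∅, fun h' => absurd h' h⟩
    choose A hA using hz
    refine ⟨(lower k w).biUnion fun z =>
      (A z).image fun c' => (Fin.snoc c' w : Fin (n + 2) → Word k), ?_, ?_⟩
    · intro c
      rw [finChain_succ]
      simp only [Finset.mem_biUnion, Finset.mem_image]
      refine exists_congr fun z => ?_
      rw [mem_lower w hw]
      refine and_congr_right fun h => ?_
      refine exists_congr fun c' => ?_
      rw [(hA z ((mem_lower w hw z).2 h)).1]
    · have hinj : Function.Injective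
          (fun c' : Fin (n + 1) → Word k => (Fin.snoc c' w : Fin (n + 2) → Word k)) := by
        intro a b h
        have := congrArg (fun f : Fin (n + 2) → Word k => Fin.init f) h
        simpa using this
      rw [Finset.card_biUnion]
      · rw [← sum_lower_F w hw (by rintro rfl; simp [rank_nil] at hr)]
        refine Finset.sum_congr rfl fun z hz => ?_
        rw [Finset.card_image_of_injective _ hinj, (hA z hz).2]
      · intro a ha b hb hab
        rw [Function.onFun, Finset.disjoint_left]
        intro c hc hc'
        simp only [Finset.mem_image] at hc hc'
        obtain ⟨c1, h1, rfl⟩ := hc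
        obtain ⟨c2, h2, h⟩ := hc'
        have := hinj h
        subst this
        rw [(hA a ha).1] at h1
        rw [(hA b hb).1] at h2
        exact hab (h1.2.2.symm.trans h2.2.2)

/-! ### Path tableaux -/

theorem entries_nil {k : ℕ} : Tab.entries ([] : Tab k) = [] := rfl

theorem entries_single {k : ℕ} (h v : ℕ) (T : Tab k) :
    Tab.entries (Col.single h v :: T) = v :: Tab.entries T := rfl

theorem entries_double {k : ℕ} (a b c d : ℕ) (T : Tab k) :
    Tab.entries (Col.double a b c d :: T) = c :: d :: Tab.entries T := rfl

/-- Remove the ribbon with value `i`. -/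
def removeTab (k i : ℕ) : Tab k → Tab k
  | [] => []
  | Col.single h v :: T => if v = i then T else Col.single h v :: removeTab k i T
  | Col.double a b c d :: T =>
      if c = i then Col.single b d :: T else Col.double a b c d :: removeTab k i T

theorem update_spec {k i : ℕ} (w : Word k) : ∀ (z : Word k) (T : Tab k),
    ZCovers k z w → Tab.shape T = z → (∀ x ∈ Tab.entries T, x < i) →
    Tab.shape (updateTab k i z w T) = w ∧ removeTab k i (updateTab k i z w T) = T ∧
      ∀ x ∈ Tab.entries (updateTab k i z w T), x < i + 1 := by
  induction w with
  | nil => intro z T h; exact absurd h (not_zcovers_nil z)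
  | cons l w ih =>
    intro z T hc hs he
    cases l with
    | one j =>
      rw [zcovers_one] at hc
      obtain ⟨-, rfl⟩ := hc
      have hu : updateTab k i z (Letter.one j :: z) T = Col.single j i :: T := by
        rcases z with _ | ⟨_ | _, z⟩ <;> simp [updateTab]
      rw [hu]
      refine ⟨by simpa [Tab.shape, Col.shape] using hs, by simp [removeTab], ?_⟩
      intro x hx
      rw [entries_single, List.mem_cons] at hx
      rcases hx with rfl | hx
      · omega
      · exact Nat.lt_succ_of_lt (he x hx)
    | two =>
      rw [zcovers_two] at hc
      rcases hc with ⟨j, -, rfl⟩ | ⟨z', rfl, hc⟩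
      · rcases T with _ | ⟨⟨h, v⟩ | _, T⟩
        · simp [Tab.shape] at hs
        · simp [Tab.shape, Col.shape] at hs
          obtain ⟨rfl, hs⟩ := hs
          simp only [updateTab]
          refine ⟨by simpa [Tab.shape, Col.shape] using hs, by simp [removeTab], ?_⟩
          intro x hx
          simp only [entries_double, entries_single, List.mem_cons] at hx he
          rcases hx with rfl | hx
          · omega
          · exact Nat.lt_succ_of_lt (he x hx)
        · simp [Tab.shape, Col.shape] at hs
      · rcases T with _ | ⟨_ | ⟨a, b, c, d⟩, T⟩
        · simp [Tab.shape] at hs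
        · simp [Tab.shape, Col.shape] at hs
        · simp only [Tab.shape, List.map_cons, Col.shape, List.cons.injEq, true_and] at hs
          simp only [entries_double, List.mem_cons] at he
          obtain ⟨h1, h2, h3⟩ := ih z' T hc hs (fun x hx => he x (by simp [hx]))
          simp only [updateTab]
          refine ⟨by simpa [Tab.shape, Col.shape] using h1, ?_, ?_⟩
          · have := he c (by simp)
            rw [removeTab, if_neg (by omega), h2]
          · intro x hx
            simp only [entries_double, List.mem_cons] at hx
            rcases hx with rfl | rfl | hx
            · exact Nat.lt_succ_of_lt (he _ (by simp))
            · exact Nat.lt_succ_of_lt (he _ (by simp))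
            · exact h3 x hx

theorem chainTab_spec {k : ℕ} (c : ℕ → Word k) (n : ℕ) (hc : IsZChain k n c) :
    Tab.shape (chainTab k c n) = c n ∧ ∀ x ∈ Tab.entries (chainTab k c n), x < n + 1 := by
  induction n with
  | zero => exact ⟨hc.1.symm, by simp [chainTab, entries_nil]⟩
  | succ n ih =>
    obtain ⟨h1, h2⟩ := ih ⟨hc.1, fun i hi => hc.2 i (by omega)⟩
    obtain ⟨h3, -, h4⟩ := update_spec (c (n + 1)) (c n) _ (hc.2 n (by omega)) h1 h2
    exact ⟨h3, h4⟩

theorem chainTab_inj {k : ℕ} (c d : ℕ → Word k) (n : ℕ) (hc : IsZChain k n c)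
    (hd : IsZChain k n d) (h : chainTab k c n = chainTab k d n) : ∀ i ≤ n, c i = d i := by
  induction n with
  | zero =>
    intro i hi
    obtain rfl : i = 0 := by omega
    rw [hc.1, hd.1]
  | succ n ih =>
    have hc' : IsZChain k n c := ⟨hc.1, fun i hi => hc.2 i (by omega)⟩
    have hd' : IsZChain k n d := ⟨hd.1, fun i hi => hd.2 i (by omega)⟩
    intro i hi
    rcases Nat.lt_or_ge n i with hlt | hge
    · obtain rfl : i = n + 1 := by omega
      rw [← (chainTab_spec c _ hc).1, ← (chainTab_spec d _ hd).1, h]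
    · refine ih hc' hd' ?_ i hge
      have e1 := chainTab_spec c n hc'
      have e2 := chainTab_spec d n hd'
      rw [← (update_spec (c (n + 1)) (c n) _ (hc.2 n (by omega)) e1.1 e1.2).2.1,
        ← (update_spec (d (n + 1)) (d n) _ (hd.2 n (by omega)) e2.1 e2.2).2.1]
      exact congrArg _ h

/-- Extend a finite chain to all of `ℕ`. -/
def extend {k n : ℕ} (c : Fin (n + 1) → Word k) : ℕ → Word k :=
  fun i => if h : i < n + 1 then c ⟨i, h⟩ else []

theorem extend_chain {k n : ℕ} (w : Word k) (c : Fin (n + 1) → Word k)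
    (hc : FinChain k n w c) : IsZChain k n (extend c) ∧ extend c n = w := by
  obtain ⟨h0, h1, h2⟩ := hc
  refine ⟨⟨?_, ?_⟩, ?_⟩
  · simpa [extend] using h0
  · intro i hi
    have := h1 ⟨i, hi⟩
    simp only [extend]
    rw [dif_pos (by omega), dif_pos (by omega)]
    exact this
  · simp only [extend]
    rw [dif_pos (by omega)]
    exact h2

theorem chainTab_congr {k : ℕ} (c d : ℕ → Word k) (n : ℕ) (h : ∀ i ≤ n, c i = d i) :
    chainTab k c n = chainTab k d n := by
  induction n with
  | zero => rfl
  | succ n ih =>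
    rw [chainTab, chainTab, ih fun i hi => h i (by omega), h n (by omega), h (n + 1) le_rfl]

theorem card_path {k n : ℕ} (w : Word k) :
    Nat.card {T : Tab k // IsPathTab k n T ∧ Tab.shape T = w} = chainCount k n w := by
  symm
  unfold chainCount
  refine Nat.card_congr (Equiv.ofBijective (fun c => ⟨chainTab k (extend c.1) n, ?_, ?_⟩) ⟨?_, ?_⟩)
  · exact ⟨_, (extend_chain w c.1 c.2).1, rfl⟩
  · obtain ⟨h1, h2⟩ := extend_chain w c.1 c.2
    rw [(chainTab_spec _ n h1).1, h2]
  · intro c d h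
    have h' : chainTab k (extend c.1) n = chainTab k (extend d.1) n := congrArg Subtype.val h
    have := chainTab_inj _ _ n (extend_chain w c.1 c.2).1 (extend_chain w d.1 d.2).1 h'
    apply Subtype.ext
    funext i
    have hi := this i.1 (by omega)
    simp only [extend] at hi
    rw [dif_pos i.2, dif_pos i.2] at hi
    exact hi
  · rintro ⟨T, ⟨c, hc, rfl⟩, hs⟩
    have h1 := (chainTab_spec c n hc).1
    refine ⟨⟨fun i => c i.1, hc.1, fun i => hc.2 i.1 i.2, ?_⟩, ?_⟩
    · rw [← hs, h1]
      rfl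
    · apply Subtype.ext
      refine chainTab_congr _ _ n fun i hi => ?_
      simp only [extend]
      rw [dif_pos (by omega)]

/-! ### Standard tableaux -/

/-- Recursive form of standardness. -/
def RStd (k : ℕ) : Tab k → Prop
  | [] => True
  | Col.single h v :: T => (1 ≤ h ∧ h ≤ k) ∧ (∀ x ∈ Tab.entries T, x < v) ∧ RStd k T
  | Col.double a b c d :: T =>
      (1 ≤ a ∧ a ≤ k ∧ b = k + 1 - a) ∧ c < d ∧ (∀ x ∈ Tab.entries T, x < d) ∧ RStd k T

theorem bottoms_sub {k : ℕ} (T : Tab k) : ∀ x ∈ Tab.bottoms T, x ∈ Tab.entries T := by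
  induction T with
  | nil => simp [Tab.bottoms]
  | cons c T ih =>
    intro x hx
    simp only [Tab.bottoms, List.map_cons, List.mem_cons] at hx ih
    cases c with
    | single h v =>
      rw [entries_single, List.mem_cons]
      rcases hx with rfl | hx
      · exact Or.inl rfl
      · exact Or.inr (ih x hx)
    | double a b c d =>
      rw [entries_double, List.mem_cons, List.mem_cons]
      rcases hx with rfl | hx
      · exact Or.inr (Or.inl rfl)
      · exact Or.inr (Or.inr (ih x hx))

theorem entries_lt {k : ℕ} (v : ℕ) (T : Tab k)
    (hT : ∀ c ∈ T, ∀ ht hb vt vb, c = Col.double ht hb vt vb → vt < vb)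
    (hb : ∀ x ∈ Tab.bottoms T, x < v) : ∀ x ∈ Tab.entries T, x < v := by
  induction T with
  | nil => simp [entries_nil]
  | cons c T ih =>
    have ih' := ih (fun c hc => hT c (by simp [hc]))
      (fun x hx => hb x (by simp only [Tab.bottoms, List.map_cons, List.mem_cons]; exact Or.inr hx))
    have h0 := hb c.bottomVal (by simp [Tab.bottoms])
    intro x hx
    cases c with
    | single h v =>
      rw [entries_single, List.mem_cons] at hx
      rcases hx with rfl | hx
      · exact h0
      · exact ih' x hx
    | double a b c d =>
      have h1 := hT _ (by simp) a b c d rfl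
      simp only [Col.bottomVal] at h0
      rw [entries_double, List.mem_cons, List.mem_cons] at hx
      rcases hx with rfl | rfl | hx
      · omega
      · exact h0
      · exact ih' x hx

theorem rstd_iff {k : ℕ} (T : Tab k) : RStd k T ↔
    (∀ c ∈ T, Col.HeightsValid k c) ∧
    List.Pairwise (fun a b => b < a) (Tab.bottoms T) ∧
    (∀ c ∈ T, ∀ ht hb vt vb, c = Col.double ht hb vt vb → vt < vb) := by
  induction T with
  | nil => simp [RStd, Tab.bottoms]
  | cons c T ih =>
    have key : (∀ c ∈ T, ∀ ht hb vt vb, c = Col.double ht hb vt vb → vt < vb) → ∀ v,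
        ((∀ x ∈ Tab.bottoms T, x < v) ↔ ∀ x ∈ Tab.entries T, x < v) := fun h v =>
      ⟨entries_lt v T h, fun h x hx => h x (bottoms_sub T x hx)⟩
    have hb : Tab.bottoms (c :: T) = c.bottomVal :: Tab.bottoms T := rfl
    rw [hb, List.pairwise_cons, List.forall_mem_cons, List.forall_mem_cons]
    cases c with
    | single h v =>
      simp only [RStd, ih, Col.HeightsValid, Col.bottomVal]
      constructor
      · rintro ⟨h1, h2, h3, h4, h5⟩
        exact ⟨⟨h1, h3⟩, ⟨(key h5 v).2 h2, h4⟩, by simp, h5⟩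
      · rintro ⟨⟨h1, h3⟩, ⟨h2, h4⟩, -, h5⟩
        exact ⟨h1, (key h5 v).1 h2, h3, h4, h5⟩
    | double a b c d =>
      simp only [RStd, ih, Col.HeightsValid, Col.bottomVal]
      constructor
      · rintro ⟨h1, h0, h2, h3, h4, h5⟩
        refine ⟨⟨h1, h3⟩, ⟨(key h5 d).2 h2, h4⟩, ?_, h5⟩
        intro _ _ _ _ h
        cases h
        exact h0
      · rintro ⟨⟨h1, h3⟩, ⟨h2, h4⟩, h0, h5⟩
        exact ⟨h1, h0 a b c d rfl, (key h5 d).1 h2, h3, h4, h5⟩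

theorem coe_cons_eq_val (v : ℕ) (l : List ℕ) (S : Finset ℕ) :
    ((v :: l : List ℕ) : Multiset ℕ) = S.val ↔
      v ∈ S ∧ (l : Multiset ℕ) = (S.erase v).val := by
  rw [Finset.erase_val, ← Multiset.cons_coe]
  constructor
  · intro h
    have hv : v ∈ S := by rw [← Finset.mem_val, ← h]; simp
    exact ⟨hv, by rw [← h]; simp⟩
  · rintro ⟨h1, h2⟩
    rw [h2]
    exact Multiset.cons_erase h1

/-- Standard tableaux of shape `w` with set of entries `S`. -/
def SStd (k : ℕ) (w : Word k) (S : Finset ℕ) (T : Tab k) : Prop :=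
  RStd k T ∧ (Tab.entries T : Multiset ℕ) = S.val ∧ Tab.shape T = w

theorem mem_of_coe {l : List ℕ} {S : Finset ℕ} (h : (l : Multiset ℕ) = S.val) (x : ℕ) :
    x ∈ l ↔ x ∈ S := by
  rw [← Finset.mem_val, ← h]; simp

theorem sstd_one {k : ℕ} (j : ℕ) (hj : 1 ≤ j ∧ j ≤ k) (w : Word k) (S : Finset ℕ) (m : ℕ)
    (hm : m ∈ S) (hmax : ∀ x ∈ S, x ≤ m) (T : Tab k) :
    SStd k (Letter.one j :: w) S T ↔
      ∃ T', SStd k w (S.erase m) T' ∧ Col.single j m :: T' = T := by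
  constructor
  · rintro ⟨h1, h2, h3⟩
    rcases T with _ | ⟨⟨h, v⟩ | _, T⟩
    · simp [Tab.shape] at h3
    · simp [Tab.shape, Col.shape] at h3
      obtain ⟨rfl, h3⟩ := h3
      rw [entries_single] at h2
      have hmem := mem_of_coe h2
      rw [coe_cons_eq_val] at h2
      obtain ⟨-, h5, h6⟩ := h1
      obtain rfl : v = m := by
        apply le_antisymm (hmax v h2.1)
        rcases List.mem_cons.1 ((hmem m).2 hm) with h | h
        · omega
        · exact (h5 m h).le
      exact ⟨T, ⟨h6, h2.2, h3⟩, rfl⟩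
    · simp [Tab.shape, Col.shape] at h3
  · rintro ⟨T', ⟨h1, h2, h3⟩, rfl⟩
    refine ⟨⟨hj, fun x hx => ?_, h1⟩, ?_, ?_⟩
    · rw [mem_of_coe h2, Finset.mem_erase] at hx
      exact lt_of_le_of_ne (hmax x hx.2) hx.1
    · rw [entries_single, coe_cons_eq_val]
      exact ⟨hm, h2⟩
    · simpa [Tab.shape, Col.shape] using h3

theorem sstd_two {k : ℕ} (w : Word k) (S : Finset ℕ) (m : ℕ)
    (hm : m ∈ S) (hmax : ∀ x ∈ S, x ≤ m) (T : Tab k) :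
    SStd k (Letter.two :: w) S T ↔
      ∃ p : ℕ × ℕ, p ∈ Finset.Icc 1 k ×ˢ S.erase m ∧
      ∃ T', SStd k w ((S.erase m).erase p.2) T' ∧
        Col.double p.1 (k + 1 - p.1) p.2 m :: T' = T := by
  constructor
  · rintro ⟨h1, h2, h3⟩
    rcases T with _ | ⟨_ | ⟨a, b, c, d⟩, T⟩
    · simp [Tab.shape] at h3
    · simp [Tab.shape, Col.shape] at h3
    · simp only [Tab.shape, List.map_cons, Col.shape, List.cons.injEq, true_and] at h3
      obtain ⟨⟨ha1, ha2, rfl⟩, h4, h5, h6⟩ := h1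
      rw [entries_double] at h2
      have hmem := mem_of_coe h2
      rw [Multiset.coe_eq_coe.2 (List.Perm.swap d c _), coe_cons_eq_val, coe_cons_eq_val] at h2
      obtain rfl : d = m := by
        apply le_antisymm (hmax d h2.1)
        have := (hmem m).2 hm
        simp only [List.mem_cons] at this
        rcases this with h | h | h
        · omega
        · omega
        · exact (h5 m h).le
      exact ⟨(a, c), by simp only [Finset.mem_product, Finset.mem_Icc]; exact ⟨⟨ha1, ha2⟩, h2.2.1⟩,
        T, ⟨h6, h2.2.2, h3⟩, rfl⟩
  · rintro ⟨⟨a, c⟩, hp, T', ⟨h1, h2, h3⟩, rfl⟩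
    simp only [Finset.mem_product, Finset.mem_Icc] at hp
    obtain ⟨⟨ha1, ha2⟩, hc⟩ := hp
    have hc' := Finset.mem_erase.1 hc
    refine ⟨⟨⟨ha1, ha2, rfl⟩, lt_of_le_of_ne (hmax c hc'.2) hc'.1, fun x hx => ?_, h1⟩, ?_, ?_⟩
    · rw [mem_of_coe h2, Finset.mem_erase, Finset.mem_erase] at hx
      exact lt_of_le_of_ne (hmax x hx.2.2) hx.2.1
    · rw [entries_double, Multiset.coe_eq_coe.2 (List.Perm.swap m c _), coe_cons_eq_val,
        coe_cons_eq_val]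
      exact ⟨hm, hc, h2⟩
    · simpa [Tab.shape, Col.shape] using h3

theorem std_finset {k : ℕ} (w : Word k) : Word.Valid k w → ∀ S : Finset ℕ,
    S.card = Word.rank w →
    ∃ A : Finset (Tab k), (∀ T, T ∈ A ↔ SStd k w S T) ∧ A.card = F k w := by
  induction w with
  | nil =>
    intro _ S hS
    rw [rank_nil, Finset.card_eq_zero] at hS
    subst hS
    refine ⟨{[]}, fun T => ?_, rfl⟩
    rw [Finset.mem_singleton]
    constructor
    · rintro rfl
      exact ⟨trivial, rfl, rfl⟩
    · rintro ⟨-, -, h⟩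
      simpa [Tab.shape] using h
  | cons l w ih =>
    intro hw S hS
    rw [valid_cons] at hw
    have hne : S.Nonempty := by
      rw [← Finset.card_pos, hS]
      cases l <;> simp [rank_one, rank_two]
    obtain ⟨m, hm, hmax⟩ : ∃ m ∈ S, ∀ x ∈ S, x ≤ m :=
      ⟨S.max' hne, S.max'_mem hne, fun x hx => S.le_max' x hx⟩
    have hcard := Finset.card_erase_of_mem hm
    cases l with
    | one j =>
      rw [rank_one] at hS
      obtain ⟨A, hA, hA'⟩ := ih hw.2 (S.erase m) (by omega)
      refine ⟨A.image (Col.single j m :: ·), fun T => ?_, ?_⟩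
      · rw [sstd_one j hw.1 w S m hm hmax]
        simp only [Finset.mem_image, hA]
      · rw [Finset.card_image_of_injective _ (List.cons_injective), hA', F]
    | two =>
      rw [rank_two] at hS
      have hz : ∀ c : ℕ, ∃ A : Finset (Tab k), c ∈ S.erase m →
          (∀ T, T ∈ A ↔ SStd k w ((S.erase m).erase c) T) ∧ A.card = F k w := by
        intro c
        by_cases h : c ∈ S.erase m
        · have := Finset.card_erase_of_mem h
          obtain ⟨A, hA⟩ := ih hw.2 ((S.erase m).erase c) (by omega)
          exact ⟨A, fun _ => hA⟩
        · exact ⟨∅, fun h' => absurd h' h⟩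
      choose A hA using hz
      refine ⟨(Finset.Icc 1 k ×ˢ S.erase m).biUnion fun p =>
        (A p.2).image (Col.double p.1 (k + 1 - p.1) p.2 m :: ·), fun T => ?_, ?_⟩
      · rw [sstd_two w S m hm hmax]
        simp only [Finset.mem_biUnion, Finset.mem_image]
        refine exists_congr fun p => and_congr_right fun hp => exists_congr fun T' => ?_
        rw [(hA p.2 (Finset.mem_product.1 hp).2).1]
      · rw [Finset.card_biUnion]
        · rw [Finset.sum_congr rfl (g := fun _ => F k w)]
          · rw [Finset.sum_const, Finset.card_product, Nat.card_Icc, hcard, hS, F]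
            simp
          · intro p hp
            rw [Finset.card_image_of_injective _ (List.cons_injective),
              (hA p.2 (Finset.mem_product.1 hp).2).2]
        · intro a ha b hb hab
          rw [Function.onFun, Finset.disjoint_left]
          intro c hc hc'
          simp only [Finset.mem_image] at hc hc'
          obtain ⟨c1, h1, rfl⟩ := hc
          obtain ⟨c2, h2, h⟩ := hc'
          simp only [List.cons.injEq, Col.double.injEq] at h
          exact hab (Prod.ext h.1.1.symm h.1.2.2.1.symm)

theorem standard_iff {k n : ℕ} (w : Word k) (T : Tab k) :
    (IsStandardTab k n T ∧ Tab.shape T = w) ↔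
      SStd k w ⟨(List.range' 1 n : List ℕ), List.nodup_range'⟩ T := by
  have : List.IsChain (fun a b : ℕ => b < a) (Tab.bottoms T) ↔
      List.Pairwise (fun a b : ℕ => b < a) (Tab.bottoms T) :=
    List.isChain_iff_pairwise
  unfold IsStandardTab SStd
  rw [rstd_iff, Multiset.coe_eq_coe, ← this]
  constructor
  · rintro ⟨⟨h1, h2, h3, h4⟩, h5⟩
    exact ⟨⟨h1, h3, h4⟩, h2, h5⟩
  · rintro ⟨⟨h1, h3, h4⟩, h2, h5⟩
    exact ⟨⟨h1, h2, h3, h4⟩, h5⟩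

/-- For every word `w` of rank `n` in the Fibonacci poset `Z(k)`, the
number of standard `k`-ribbon Fibonacci tableaux of shape `w` with entries `1, …, n`
equals the number of `k`-ribbon Fibonacci path tableaux of shape `w`, which in turn
equals `e(w)`, the number of saturated chains from `∅` to `w` in `Z(k)`. -/
theorem card_standard_eq_card_path (k n : ℕ) (hk : 1 ≤ k) (w : Word k)
    (hw : Word.Valid k w) (hrank : Word.rank w = n) :
    Nat.card {T : Tab k // IsStandardTab k n T ∧ Tab.shape T = w} =
      Nat.card {T : Tab k // IsPathTab k n T ∧ Tab.shape T = w} ∧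
    Nat.card {T : Tab k // IsPathTab k n T ∧ Tab.shape T = w} = chainCount k n w := by
  have hp := card_path (n := n) w
  refine ⟨?_, hp⟩
  rw [hp]
  obtain ⟨A, hA, hA'⟩ := chain_finset n w hw hrank
  obtain ⟨B, hB, hB'⟩ := std_finset w hw
    ⟨(List.range' 1 n : List ℕ), List.nodup_range'⟩ (by rw [hrank]; exact List.length_range')
  have e1 : chainCount k n w = A.card := Nat.subtype_card A hA
  rw [e1, hA', ← hB']
  exact Nat.subtype_card B fun T => (hB T).trans (standard_iff w T).symm

end KRF
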